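/- Two propositional theories Γ1 and Γ2 are relativized hyperequivalent wrt. extended A⁺-A⁻-theories (i.e., Γ1 ∪ Γ and Γ2 ∪ Γ are answer-set equivalent for every extended A⁺-A⁻-theory Γ over any L' ⊇ L) if and only if they coincide on their HT-hyperequivalence interpretations wrt. A⁺ and A⁻. -/

import Mathlib

/-- Propositional formulas over atoms of type `α`. -/
inductive PForm (α : Type) : Type where
  | atom : α → PForm α
  | bot  : PForm α
  | conj : PForm α → PForm α → PForm α
  | disj : PForm α → PForm α → PForm α
  | impl : PForm α → PForm α → PForm α

namespace PForm

variable {α : Type}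

/-- Classical satisfaction by a set of atoms. -/
def clSat (Y : Set α) : PForm α → Prop
  | atom a   => a ∈ Y
  | bot      => False
  | conj φ ψ => clSat Y φ ∧ clSat Y ψ
  | disj φ ψ => clSat Y φ ∨ clSat Y ψ
  | impl φ ψ => clSat Y φ → clSat Y ψ

/-- HT-satisfaction by a pair (X,Y) of sets of atoms. -/
def htSat (X Y : Set α) : PForm α → Prop
  | atom a   => a ∈ X
  | bot      => False
  | conj φ ψ => htSat X Y φ ∧ htSat X Y ψ
  | disj φ ψ => htSat X Y φ ∨ htSat X Y ψ
  | impl φ ψ => (htSat X Y φ → htSat X Y ψ) ∧ (clSat Y φ → clSat Y ψ)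

/-- Factual formulas: built from ∧, ∨, ⊥ and negations φ → ⊥ only. -/
def Factual : PForm α → Prop
  | atom _   => True
  | bot      => True
  | conj φ ψ => Factual φ ∧ Factual ψ
  | disj φ ψ => Factual φ ∧ Factual ψ
  | impl φ ψ => Factual φ ∧ ψ = PForm.bot

/-- All atoms of the formula belong to `L`. -/
def atomsIn (L : Set α) : PForm α → Prop
  | atom a   => a ∈ L
  | bot      => True
  | conj φ ψ => atomsIn L φ ∧ atomsIn L ψ
  | disj φ ψ => atomsIn L φ ∧ atomsIn L ψ
  | impl φ ψ => atomsIn L φ ∧ atomsIn L ψ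

end PForm

abbrev Theory (α : Type) := Set (PForm α)

variable {α : Type}

/-- An HT-interpretation (X,Y) satisfies a theory. -/
def htSatT (X Y : Set α) (Γ : Theory α) : Prop := ∀ φ ∈ Γ, PForm.htSat X Y φ

/-- Classical satisfaction of a theory. -/
def clSatT (Y : Set α) (Γ : Theory α) : Prop := ∀ φ ∈ Γ, PForm.clSat Y φ

/-- A factual theory. -/
def FactualT (Γ : Theory α) : Prop := ∀ φ ∈ Γ, PForm.Factual φ

/-- Y is an answer set of Γ, i.e. (Y,Y) is an equilibrium model of Γ. -/
def IsAnswerSet (Γ : Theory α) (Y : Set α) : Prop :=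
  htSatT Y Y Γ ∧ ∀ X, X ⊂ Y → ¬ htSatT X Y Γ

/-- Answer-set equivalence. -/
def AnswerEquiv (Γ₁ Γ₂ : Theory α) : Prop :=
  ∀ Y : Set α, IsAnswerSet Γ₁ Y ↔ IsAnswerSet Γ₂ Y

/-- Classical equivalence. -/
def ClassEquiv (Γ₁ Γ₂ : Theory α) : Prop :=
  ∀ Y : Set α, clSatT Y Γ₁ ↔ clSatT Y Γ₂

/-- Strong equivalence. -/
def StrongEquiv (Γ₁ Γ₂ : Theory α) : Prop :=
  ∀ Γ : Theory α, AnswerEquiv (Γ₁ ∪ Γ) (Γ₂ ∪ Γ)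

/-- Uniform equivalence (wrt factual theories). -/
def UnifEquiv (Γ₁ Γ₂ : Theory α) : Prop :=
  ∀ Γ : Theory α, FactualT Γ → AnswerEquiv (Γ₁ ∪ Γ) (Γ₂ ∪ Γ)

/-- The set of HT-countermodels of Γ. -/
def Cs (Γ : Theory α) : Set (Set α × Set α) :=
  {p | p.1 ⊆ p.2 ∧ ¬ htSatT p.1 p.2 Γ}

/-- The set of equivalence interpretations of Γ: total HT-models and here-countermodels. -/
def Es (Γ : Theory α) : Set (Set α × Set α) :=
  {p | p.1 ⊆ p.2 ∧
    ((p.1 = p.2 ∧ htSatT p.1 p.2 Γ) ∨ (¬ htSatT p.1 p.2 Γ ∧ clSatT p.2 Γ))}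

/-- (X,Y) is there-closed in a set S of HT-interpretations. -/
def ThereClosedIn (S : Set (Set α × Set α)) (X Y : Set α) : Prop :=
  (Y, Y) ∉ S ∧ ∀ X', X ⊆ X' → X' ⊂ Y → (X', Y) ∈ S

/-- (X,Y) is closed in a set S of HT-interpretations. -/
def ClosedIn (S : Set (Set α × Set α)) (X Y : Set α) : Prop :=
  ∀ X', X ⊆ X' → X' ⊆ Y → (X', Y) ∈ S

/-- C_u(Γ): there-closed HT-interpretations wrt the countermodels of Γ. -/
def Cu (Γ : Theory α) : Set (Set α × Set α) :=
  {p | p.1 ⊆ p.2 ∧ ThereClosedIn (Cs Γ) p.1 p.2}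


/-- Polarity-correct occurrence of atoms: `APol Ap An true φ` states that the formula φ,
itself occurring positively, has all its positively occurring atoms in `Ap` and all its
negatively occurring atoms in `An` (atoms in antecedents of implications occur negatively,
atoms in consequents occur positively; in a negatively occurring implication — e.g. the
antecedent φ₁ of (φ₁→φ₂)→φ₃ — both components additionally occur with both polarities). -/
def APol (Ap An : Set α) : Bool → PForm α → Prop
  | p, .atom a => if p then a ∈ Ap else a ∈ An
  | _, .bot => True
  | p, .conj φ ψ => APol Ap An p φ ∧ APol Ap An p ψ
  | p, .disj φ ψ => APol Ap An p φ ∧ APol Ap An p ψ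
  | true, .impl φ ψ => APol Ap An false φ ∧ APol Ap An true ψ
  | false, .impl φ ψ =>
      (APol Ap An false φ ∧ APol Ap An true φ) ∧ (APol Ap An true ψ ∧ APol Ap An false ψ)

/-- An A⁺-A⁻-theory. -/
def IsAATheory (Ap An : Set α) (Γ : Theory α) : Prop :=
  ∀ φ ∈ Γ, APol Ap An true φ

/-- An extended A⁺-A⁻-theory: additionally factual formulas over A⁺ are permitted. -/
def IsExtAATheory (Ap An : Set α) (Γ : Theory α) : Prop :=
  ∀ φ ∈ Γ, APol Ap An true φ ∨ (PForm.Factual φ ∧ PForm.atomsIn Ap φ)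

/-- Relativized hyperequivalence wrt A⁺ and A⁻. -/
def HyperEquiv (Ap An : Set α) (Γ₁ Γ₂ : Theory α) : Prop :=
  ∀ Γ : Theory α, IsAATheory Ap An Γ → AnswerEquiv (Γ₁ ∪ Γ) (Γ₂ ∪ Γ)

/-- (Y,Y) is A⁺-total: (Y ∩ A⁺, Y) is closed in E_s(Γ). -/
def ApTotal (Ap : Set α) (Γ : Theory α) (Y : Set α) : Prop :=
  ∀ X', Y ∩ Ap ⊆ X' → X' ⊆ Y → (X', Y) ∈ Es Γ

/-- (X,Y) is A⁺-closed in E_s(Γ). -/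
def ApClosed (Ap An : Set α) (Γ : Theory α) (X Y : Set α) : Prop :=
  ∀ X', X' ⊆ Y → X ∩ Ap ⊆ X' ∩ Ap → X' ∩ An ⊆ X ∩ An → (X', Y) ∈ Es Γ

/-- E^{A⁺}_{A⁻}(Γ): the HT-hyperequivalence interpretations of Γ wrt A⁺ and A⁻. -/
def Eh (Ap An : Set α) (Γ : Theory α) : Set (Set α × Set α) :=
  {p | p.1 ⊆ p.2 ∧ ApTotal Ap Γ p.2 ∧
    ∃ X', X' ⊆ p.2 ∧ p.1 = X' ∩ (Ap ∪ An) ∧ ApClosed Ap An Γ X' p.2}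

theorem aux_persist (X Y : Set α) (h : X ⊆ Y) (φ : PForm α) :
    PForm.htSat X Y φ → PForm.clSat Y φ := by
  induction φ with
  | atom a => exact fun ha => h ha
  | bot => exact id
  | conj φ ψ ih1 ih2 => exact fun ⟨a, b⟩ => ⟨ih1 a, ih2 b⟩
  | disj φ ψ ih1 ih2 => exact fun hh => hh.imp ih1 ih2
  | impl φ ψ ih1 ih2 => exact fun hh => hh.2

theorem aux_total (Y : Set α) (φ : PForm α) :
    PForm.htSat Y Y φ ↔ PForm.clSat Y φ := by
  induction φ with
  | atom a => exact Iff.rfl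
  | bot => exact Iff.rfl
  | conj φ ψ ih1 ih2 => exact and_congr ih1 ih2
  | disj φ ψ ih1 ih2 => exact or_congr ih1 ih2
  | impl φ ψ ih1 ih2 =>
    exact ⟨fun hh => hh.2, fun hh => ⟨fun a => ih2.2 (hh (ih1.1 a)), hh⟩⟩

theorem aux_pol (Ap An X X' Y : Set α) (hp : X ∩ Ap ⊆ X' ∩ Ap) (hn : X' ∩ An ⊆ X ∩ An)
    (φ : PForm α) :
    (APol Ap An true φ → PForm.htSat X Y φ → PForm.htSat X' Y φ) ∧
    (APol Ap An false φ → PForm.htSat X' Y φ → PForm.htSat X Y φ) := by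
  induction φ with
  | atom a =>
    constructor
    · intro h hx
      exact (hp ⟨hx, by simpa [APol] using h⟩).1
    · intro h hx
      exact (hn ⟨hx, by simpa [APol] using h⟩).1
  | bot => exact ⟨fun _ => id, fun _ => id⟩
  | conj φ ψ ih1 ih2 =>
    simp only [APol, PForm.htSat]
    tauto
  | disj φ ψ ih1 ih2 =>
    simp only [APol, PForm.htSat]
    tauto
  | impl φ ψ ih1 ih2 =>
    simp only [APol, PForm.htSat]
    tauto

theorem aux_fact (Ap X X' Y : Set α) (hX : X ⊆ Y) (hX' : X' ⊆ Y)
    (hp : X ∩ Ap ⊆ X' ∩ Ap) (φ : PForm α) :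
    PForm.Factual φ → PForm.atomsIn Ap φ → PForm.htSat X Y φ → PForm.htSat X' Y φ := by
  induction φ with
  | atom a => exact fun _ h hx => (hp ⟨hx, h⟩).1
  | bot => exact fun _ _ => id
  | conj φ ψ ih1 ih2 =>
    exact fun f a h => ⟨ih1 f.1 a.1 h.1, ih2 f.2 a.2 h.2⟩
  | disj φ ψ ih1 ih2 =>
    exact fun f a h => h.imp (ih1 f.1 a.1) (ih2 f.2 a.2)
  | impl φ ψ ih1 ih2 =>
    rintro ⟨_, rfl⟩ _ h
    exact ⟨fun hh => h.2 (aux_persist X' Y hX' φ hh), h.2⟩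

theorem aux_ext (Ap An X X' Y : Set α) (Γ : Theory α) (hΓ : IsExtAATheory Ap An Γ)
    (hX : X ⊆ Y) (hX' : X' ⊆ Y)
    (hp : X ∩ Ap ⊆ X' ∩ Ap) (hn : X' ∩ An ⊆ X ∩ An) (h : htSatT X Y Γ) : htSatT X' Y Γ := by
  intro φ hφ
  rcases hΓ φ hφ with h1 | ⟨h1, h2⟩
  · exact (aux_pol Ap An X X' Y hp hn φ).1 h1 (h φ hφ)
  · exact aux_fact Ap X X' Y hX hX' hp φ h1 h2 (h φ hφ)

theorem aux_totalT (Y : Set α) (Γ : Theory α) : htSatT Y Y Γ ↔ clSatT Y Γ :=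
  forall_congr' fun φ => forall_congr' fun _ => aux_total Y φ

theorem aux_union (X Y : Set α) (Γ Δ : Theory α) :
    htSatT X Y (Γ ∪ Δ) ↔ htSatT X Y Γ ∧ htSatT X Y Δ := by
  constructor
  · exact fun h => ⟨fun φ hφ => h φ (Or.inl hφ), fun φ hφ => h φ (Or.inr hφ)⟩
  · rintro ⟨h1, h2⟩ φ (h | h)
    · exact h1 φ h
    · exact h2 φ h

theorem aux_mem (X Y : Set α) (Γ : Theory α) :
    (X, Y) ∈ Es Γ ↔ X ⊆ Y ∧ htSatT Y Y Γ ∧ (X ≠ Y → ¬ htSatT X Y Γ) := by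
  simp only [Es, Set.mem_setOf_eq]
  constructor
  · rintro ⟨h, ⟨rfl, h1⟩ | ⟨h1, h2⟩⟩
    · exact ⟨h, h1, fun hh => absurd rfl hh⟩
    · exact ⟨h, (aux_totalT Y Γ).2 h2, fun _ => h1⟩
  · rintro ⟨h, h1, h2⟩
    refine ⟨h, ?_⟩
    by_cases e : X = Y
    · subst e; exact Or.inl ⟨rfl, h1⟩
    · exact Or.inr ⟨h2 e, (aux_totalT Y Γ).1 h1⟩

theorem aux_back (Ap An : Set α) (Γ₁ Γ₂ Γ : Theory α) (hE : Eh Ap An Γ₁ = Eh Ap An Γ₂)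
    (hΓ : IsExtAATheory Ap An Γ) (Y : Set α) (h : IsAnswerSet (Γ₁ ∪ Γ) Y) :
    IsAnswerSet (Γ₂ ∪ Γ) Y := by
  obtain ⟨hY, hmin⟩ := h
  obtain ⟨hY1, hYG⟩ := (aux_union _ _ _ _).1 hY
  have key : ∀ X', X' ⊆ Y → htSatT X' Y Γ → (X', Y) ∈ Es Γ₁ := fun X' hs hG =>
    (aux_mem _ _ _).2 ⟨hs, hY1, fun hne h1 =>
      hmin X' (HasSubset.Subset.ssubset_of_ne hs hne) ((aux_union _ _ _ _).2 ⟨h1, hG⟩)⟩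
  have clos : ∀ X, X ⊆ Y → htSatT X Y Γ → ApClosed Ap An Γ₁ X Y := fun X hX hG X' hs hp hn =>
    key X' hs (aux_ext Ap An X X' Y Γ hΓ hX hs hp hn hG)
  have tot : ApTotal Ap Γ₁ Y := fun X' hsub hs =>
    clos Y subset_rfl hYG X' hs (fun a ha => ⟨hsub ha, ha.2⟩) (fun a ha => ⟨hs ha.1, ha.2⟩)
  have all : ∀ X, X ⊆ Y → htSatT X Y Γ → (X ∩ (Ap ∪ An), Y) ∈ Eh Ap An Γ₂ := by
    intro X hX hG
    rw [← hE]
    exact ⟨fun a ha => hX ha.1, tot, X, hX, rfl, clos X hX hG⟩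
  have hY2 : htSatT Y Y Γ₂ :=
    ((aux_mem _ _ _).1 ((all Y subset_rfl hYG).2.1 Y Set.inter_subset_left subset_rfl)).2.1
  refine ⟨(aux_union _ _ _ _).2 ⟨hY2, hYG⟩, ?_⟩
  intro X hX hsat
  obtain ⟨h2, hG⟩ := (aux_union _ _ _ _).1 hsat
  obtain ⟨_, _, X'', hs, he, hc⟩ := all X hX.1 hG
  simp only at he hs hc
  have hmem : (X, Y) ∈ Es Γ₂ := by
    have e : ∀ a, a ∈ X ∩ (Ap ∪ An) ↔ a ∈ X'' ∩ (Ap ∪ An) := fun a => by rw [he]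
    refine hc X hX.1 ?_ ?_
    · exact fun a ha => ⟨((e a).2 ⟨ha.1, Or.inl ha.2⟩).1, ha.2⟩
    · exact fun a ha => ⟨((e a).1 ⟨ha.1, Or.inr ha.2⟩).1, ha.2⟩
  exact ((aux_mem _ _ _).1 hmem).2.2 hX.ne h2

theorem aux_forw (Ap An : Set α) (Γ₁ Γ₂ : Theory α)
    (H : ∀ Γ : Theory α, IsExtAATheory Ap An Γ → AnswerEquiv (Γ₁ ∪ Γ) (Γ₂ ∪ Γ)) :
    Eh Ap An Γ₁ ⊆ Eh Ap An Γ₂ := by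
  have gen : ∀ X Y : Set α, X ⊆ Y → ApTotal Ap Γ₁ Y → ApClosed Ap An Γ₁ X Y →
      ApClosed Ap An Γ₂ X Y := by
    intro X Y hX ht hc
    let Γ : Theory α := {φ | (∃ a ∈ X ∩ Ap, φ = .atom a) ∨
      ∃ b ∈ (Y \ X) ∩ An, ∃ a ∈ Y ∩ Ap, φ = .impl (.atom b) (.atom a)}
    have hΓ : IsExtAATheory Ap An Γ := by
      rintro φ (⟨a, ha, rfl⟩ | ⟨b, hb, a, ha, rfl⟩)
      · left; simpa [APol] using ha.2
      · left; simpa [APol] using ⟨hb.2, ha.2⟩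
    have hYG : htSatT Y Y Γ := by
      rintro φ (⟨a, ha, rfl⟩ | ⟨b, hb, a, ha, rfl⟩)
      · exact hX ha.1
      · exact ⟨fun _ => ha.1, fun _ => ha.1⟩
    have hY1 : htSatT Y Y Γ₁ :=
      ((aux_mem _ _ _).1 (ht Y Set.inter_subset_left subset_rfl)).2.1
    have ans : IsAnswerSet (Γ₁ ∪ Γ) Y := by
      refine ⟨(aux_union _ _ _ _).2 ⟨hY1, hYG⟩, ?_⟩
      intro X' hX' hsat
      obtain ⟨h1, hG⟩ := (aux_union _ _ _ _).1 hsat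
      have hp : X ∩ Ap ⊆ X' ∩ Ap := fun a ha => ⟨hG (.atom a) (Or.inl ⟨a, ha, rfl⟩), ha.2⟩
      have hmem : (X', Y) ∈ Es Γ₁ := by
        by_cases hn : X' ∩ An ⊆ X ∩ An
        · exact hc X' hX'.1 hp hn
        · obtain ⟨b, hb, hb'⟩ := Set.not_subset.1 hn
          refine ht X' (fun a ha => ?_) hX'.1
          exact (hG (.impl (.atom b) (.atom a)) (Or.inr ⟨b,
            ⟨⟨hX'.1 hb.1, fun hx => hb' ⟨hx, hb.2⟩⟩, hb.2⟩, a, ha, rfl⟩)).1 hb.1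
      exact ((aux_mem _ _ _).1 hmem).2.2 hX'.ne h1
    obtain ⟨hY, hmin⟩ := (H Γ hΓ Y).1 ans
    intro X' hs hp hn
    refine (aux_mem _ _ _).2 ⟨hs, ((aux_union _ _ _ _).1 hY).1, fun hne h2 => ?_⟩
    refine hmin X' (HasSubset.Subset.ssubset_of_ne hs hne) ((aux_union _ _ _ _).2 ⟨h2, ?_⟩)
    rintro φ (⟨a, ha, rfl⟩ | ⟨b, hb, a, ha, rfl⟩)
    · exact (hp ha).1
    · exact ⟨fun hx => absurd (hn ⟨hx, hb.2⟩).1 hb.1.2, fun _ => ha.1⟩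
  rintro ⟨Z, Y⟩ ⟨hZ, ht, X, hX, he, hc⟩
  refine ⟨hZ, ?_, X, hX, he, gen X Y hX ht hc⟩
  have cY : ApClosed Ap An Γ₁ Y Y := fun X' hs hp _ => ht X' (fun a ha => (hp ha).1) hs
  exact fun X' hsub hs => gen Y Y subset_rfl ht cY X' hs
    (fun a ha => ⟨hsub ha, ha.2⟩) (fun a ha => ⟨hs ha.1, ha.2⟩)

/-- Γ₁ and Γ₂ are relativized hyperequivalent wrt extended A⁺-A⁻-theories
iff they coincide on their HT-hyperequivalence interpretations wrt A⁺ and A⁻. -/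
theorem ext_hyperequivalence_characterization (Ap An : Set α) (Γ₁ Γ₂ : Theory α) :
    (∀ Γ : Theory α, IsExtAATheory Ap An Γ → AnswerEquiv (Γ₁ ∪ Γ) (Γ₂ ∪ Γ)) ↔
      Eh Ap An Γ₁ = Eh Ap An Γ₂ := by
  constructor
  · intro H
    exact Set.Subset.antisymm (aux_forw Ap An Γ₁ Γ₂ H)
      (aux_forw Ap An Γ₂ Γ₁ (fun Γ h Y => (H Γ h Y).symm))
  · intro hE Γ hΓ Y
    exact ⟨aux_back Ap An Γ₁ Γ₂ Γ hE hΓ Y, aux_back Ap An Γ₂ Γ₁ Γ hE.symm hΓ Y⟩
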